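/- Specker's theorem: if κ^{<κ} = κ then there exists a special κ⁺-Aronszajn tree; in particular, if κ is a strong (or merely inaccessible) cardinal, then κ^{<κ}=κ and hence the tree property fails at κ⁺ (there is a κ⁺-Aronszajn tree). -/

import Mathlib

open Cardinal

/-- The level (height) of a node of a tree: the order type of its set of predecessors. -/
noncomputable def lvl {α : Type} [PartialOrder α]
    [inst : ∀ t : α, IsWellOrder {s : α // s < t} (· < ·)] (t : α) : Ordinal :=
  Ordinal.type ((· < ·) : {s : α // s < t} → {s : α // s < t} → Prop)

/-- There is a `κ⁺`-Aronszajn tree: height `κ⁺`, levels of size `≤ κ`, no cofinal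
branch; `special` additionally requires it to be the union of `κ` many antichains. -/
def ExistsAronszajn (κ : Cardinal) (special : Prop → Prop := id) : Prop :=
  ∃ (α : Type) (_ : PartialOrder α) (_ : ∀ t : α, IsWellOrder {s : α // s < t} (· < ·)),
    (∀ t : α, lvl t < (Order.succ κ).ord) ∧
    (∀ o : Ordinal, o < (Order.succ κ).ord → ∃ t : α, lvl t = o) ∧
    (∀ o : Ordinal, Cardinal.mk {t : α // lvl t = o} ≤ κ) ∧
    (¬ ∃ B : Set α, IsChain (· ≤ ·) B ∧
        ∀ o : Ordinal, o < (Order.succ κ).ord → ∃ t ∈ B, lvl t = o) ∧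
    special (∃ (ι : Type) (_ : Cardinal.mk ι ≤ κ) (g : α → ι),
      ∀ s t : α, s < t → g s ≠ g t)

theorem spk_regular {κ : Cardinal.{0}} (hκ : ℵ₀ ≤ κ) (h : κ ^< κ = κ) : κ.IsRegular := by
  refine ⟨hκ, ?_⟩
  by_contra hc
  push Not at hc
  have h1 := lt_power_cof_ord hκ
  have h2 := le_powerlt κ hc
  rw [h] at h2
  exact absurd h1 (not_lt.2 h2)

theorem spk_mk_small {κ : Cardinal.{0}} (hκ : ℵ₀ ≤ κ) (h : κ ^< κ = κ) (X : Type)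
    (hX : #X ≤ κ) : #{s : Set X // #s < κ} ≤ κ := by
  have key : ∀ s : {s : Set X // #s < κ}, ∃ i : κ.ord.ToType, #s.1 ≤ #(Set.Iio i) := by
    rintro ⟨s, hs⟩
    refine ⟨Ordinal.ToType.mk ⟨(#s).ord, ord_lt_ord.2 hs⟩, ?_⟩
    have : #(Set.Iio (Ordinal.ToType.mk (o := κ.ord) ⟨(#s).ord, ord_lt_ord.2 hs⟩)) = #s := by
      rw [← Ordinal.card_type (α := Set.Iio _) (· < ·), Ordinal.type_Iio_lt]
      have : Ordinal.typein (α := κ.ord.ToType) (· < ·)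
          (Ordinal.ToType.mk ⟨(#s).ord, ord_lt_ord.2 hs⟩) = (#s).ord := by
        exact Ordinal.typein_enum (α := κ.ord.ToType) (· < ·) _
      rw [this, card_ord]
    exact this.ge
  choose f hf using key
  have h1 : #{s : Set X // #s < κ} ≤ #(Σ i : κ.ord.ToType, {t : Set X // #t ≤ #(Set.Iio i)}) := by
    refine mk_le_of_injective (f := fun s => ⟨f s, s.1, hf s⟩) ?_
    intro s t hst
    simp only [Sigma.mk.injEq] at hst
    obtain ⟨h1, h2⟩ := hst
    have : ∀ (i j : κ.ord.ToType) (a : {t : Set X // #t ≤ #(Set.Iio i)})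
      (b : {t : Set X // #t ≤ #(Set.Iio j)}), i = j → HEq a b → a.1 = b.1 := by
      rintro i j a b rfl hab
      rw [eq_of_heq hab]
    exact Subtype.ext (this _ _ _ _ h1 h2)
  refine h1.trans ?_
  rw [mk_sigma]
  have h2 : ∀ i : κ.ord.ToType, #{t : Set X // #t ≤ #(Set.Iio i)} ≤ κ := by
    intro i
    refine (mk_bounded_set_le X _).trans ?_
    refine (power_le_power_right (max_le hX hκ)).trans ?_
    have := le_powerlt κ (show #(Set.Iio i) < κ by simpa using mk_Iio_lt i)
    rwa [h] at this
  refine (sum_le_sum _ _ h2).trans ?_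
  rw [sum_const']
  simp [mul_eq_self hκ]

theorem spk_inacc {κ : Cardinal.{0}} (hi : κ.IsInaccessible) : κ ^< κ = κ := by
  have h1 : ℵ₀ ≤ κ := hi.isRegular.1
  refine le_antisymm ?_ ?_
  · rw [powerlt_le]
    intro c hc
    induction c using Cardinal.inductionOn with | _ C =>
    let X := C × κ.ord.ToType
    by_cases hC : IsEmpty C
    · rw [mk_eq_zero C, power_zero]
      exact one_le_aleph0.trans h1
    have hX : #X = κ := by
      simp only [X, mk_prod, mk_ord_toType, lift_id]
      apply mul_eq_right h1 hc.le
      simpa [mk_eq_zero_iff] using hC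
    have h2 := mk_subset_mk_lt_cof (α := X) (by rw [hX]; exact hi.isStrongLimit.isStrongPrelimit)
    rw [hX, hi.isRegular.cof_ord] at h2
    calc κ ^ #C = #(C → κ.ord.ToType) := by simp
      _ ≤ #{s : Set X // #s < κ} := by
        refine mk_le_of_injective (f := fun f => ⟨Set.range fun c => (c, f c), mk_range_le.trans_lt hc⟩) ?_
        intro f g hfg
        simp only [Subtype.mk.injEq] at hfg
        funext c
        have : (c, f c) ∈ Set.range fun c => (c, g c) := hfg ▸ ⟨c, rfl⟩
        obtain ⟨d, hd⟩ := this
        simp only [Prod.mk.injEq] at hd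
        rw [← hd.2, hd.1]
      _ = κ := h2
  · have := le_powerlt κ (show 1 < κ by simpa using hi.isRegular.nat_lt 1)
    simpa using this

theorem spk_coh {Ω K : Type} [LinearOrder Ω] [WellFoundedLT Ω] [LinearOrder K] [WellFoundedLT K]
    [Nonempty K] {κ : Cardinal.{0}} (hr : κ.IsRegular) (hK : ∀ i : K, #(Set.Iic i) < κ)
    (hΩ : ∀ γ : Ω, #(Set.Iio γ) ≤ #K) :
    ∃ e : Ω → Ω → K, (∀ γ v, #{ξ | ξ ≤ γ ∧ e γ ξ ≤ v} < κ) ∧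
      ∀ γ β, β ≤ γ → #{ξ | ξ ≤ β ∧ e β ξ ≠ e γ ξ} < κ := by
  classical
  have hc : ∀ γ : Ω, ∃ c : K → Ω, ∀ β < γ, ∃ i, c i = β := by
    intro γ
    obtain ⟨g⟩ := hΩ γ
    refine ⟨Function.extend g Subtype.val (fun _ => γ), fun β hβ => ⟨g ⟨β, hβ⟩, ?_⟩⟩
    rw [g.injective.extend_apply]
  choose c hc using hc
  let P : Ω → Ω → K → Prop := fun γ ξ i => c γ i < γ ∧ ξ ≤ c γ i
  let F : (γ : Ω) → ((β : Ω) → β < γ → Ω → K) → Ω → K := fun γ ih ξ =>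
    if h : ∃ i, P γ ξ i then
      max ((wellFounded_lt (α := K)).min {i | P γ ξ i} h)
        (ih (c γ ((wellFounded_lt (α := K)).min {i | P γ ξ i} h))
          ((wellFounded_lt (α := K)).min_mem {i | P γ ξ i} h).1 ξ)
    else Classical.arbitrary K
  let e : Ω → Ω → K := (wellFounded_lt (α := Ω)).fix F
  have he : ∀ γ ξ, ξ < γ → ∃ i, c γ i < γ ∧ ξ ≤ c γ i ∧ (∀ j, c γ j < γ → ξ ≤ c γ j → i ≤ j) ∧
      e γ ξ = max i (e (c γ i) ξ) := by
    intro γ ξ hξ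
    have h : ∃ i, P γ ξ i := by
      obtain ⟨i, hi⟩ := hc γ ξ hξ
      exact ⟨i, by rw [hi]; exact hξ, hi.ge⟩
    refine ⟨(wellFounded_lt (α := K)).min {i | P γ ξ i} h,
      ((wellFounded_lt (α := K)).min_mem {i | P γ ξ i} h).1,
      ((wellFounded_lt (α := K)).min_mem {i | P γ ξ i} h).2, ?_, ?_⟩
    · intro j h1 h2
      exact (wellFounded_lt (α := K)).min_le (show j ∈ {i | P γ ξ i} from ⟨h1, h2⟩)
    · have : e γ = F γ (fun β _ => e β) := (wellFounded_lt (α := Ω)).fix_eq F γ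
      rw [this]
      simp only [F, dif_pos h]
  have mono : ∀ {s t : Set Ω}, s ⊆ t → #t < κ → #s < κ := fun h1 h2 =>
    (mk_le_mk_of_subset h1).trans_lt h2
  have union : ∀ {s t : Set Ω}, #s < κ → #t < κ → #(s ∪ t : Set Ω) < κ := fun h1 h2 =>
    (mk_union_le _ _).trans_lt (add_lt_of_lt hr.1 h1 h2)
  have iun : ∀ (j : K) (t : K → Set Ω), (∀ i ≤ j, #(t i) < κ) →
      #(⋃ i : Set.Iic j, t i : Set Ω) < κ := fun j t h =>
    (card_iUnion_lt_iff_forall_of_isRegular hr (hK j)).2 fun i => h i i.2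
  have sing : ∀ x : Ω, #({x} : Set Ω) < κ := fun x => by
    simpa using hr.nat_lt 1
  have h1 : ∀ γ v, #{ξ | ξ ≤ γ ∧ e γ ξ ≤ v} < κ := by
    intro γ
    induction γ using WellFoundedLT.induction with | _ γ ih =>
    intro v
    refine mono ?_ (union (sing γ) (iun v
      (fun i => if c γ i < γ then {ξ | ξ ≤ c γ i ∧ e (c γ i) ξ ≤ v} else ∅) ?_))
    · rintro ξ ⟨h1, h2⟩
      rcases h1.eq_or_lt with h1 | h1
      · left; exact h1
      · right
        obtain ⟨i, a1, a2, a3, a4⟩ := he γ ξ h1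
        rw [a4, max_le_iff] at h2
        refine Set.mem_iUnion.2 ⟨⟨i, h2.1⟩, ?_⟩
        simp only [if_pos a1]
        exact ⟨a2, h2.2⟩
    · intro i hi
      split_ifs with h
      · exact ih _ h v
      · simpa using hr.pos
  refine ⟨e, h1, ?_⟩
  intro γ
  induction γ using WellFoundedLT.induction with | _ γ ih =>
  intro β hβ
  rcases hβ.eq_or_lt with rfl | hβ
  · simpa using hr.pos
  obtain ⟨j, b1, b2, b3, b4⟩ := he γ β hβ
  refine mono ?_ (iun j (fun i => if c γ i < γ then
      {ξ | ξ ≤ c γ i ∧ e (c γ i) ξ ≤ i} ∪ {ξ | ξ ≤ min β (c γ i) ∧ e (c γ i) ξ ≠ e β ξ} else ∅) ?_)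
  · rintro ξ ⟨h2, h3⟩
    obtain ⟨i, a1, a2, a3, a4⟩ := he γ ξ (h2.trans_lt hβ)
    refine Set.mem_iUnion.2 ⟨⟨i, a3 j b1 (h2.trans b2)⟩, ?_⟩
    simp only [if_pos a1]
    by_cases h4 : e (c γ i) ξ ≤ i
    · left; exact ⟨a2, h4⟩
    · right
      refine ⟨le_min h2 a2, fun h5 => h3 ?_⟩
      rw [a4, max_eq_right (not_le.1 h4).le, h5]
  · intro i hi
    split_ifs with h
    · refine union (h1 _ _) ?_
      rcases le_total β (c γ i) with h5 | h5
      · refine mono ?_ (ih _ h β h5)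
        rintro ξ ⟨q1, q2⟩
        exact ⟨q1.trans (min_le_left _ _), q2.symm⟩
      · refine mono ?_ (ih _ hβ _ h5)
        rintro ξ ⟨q1, q2⟩
        exact ⟨q1.trans (min_le_right _ _), q2⟩
    · simpa using hr.pos

structure SpkNode {Ω K : Type} [LinearOrder Ω] (e : Ω → Ω → K) (k : K) (κ : Cardinal.{0}) where
  top : Ω
  fn : Ω → K
  supp : ∀ ξ, top < ξ → fn ξ = k
  coh : #{ξ | ξ ≤ top ∧ fn ξ ≠ e top ξ} < κ

section
variable {Ω K : Type} [LinearOrder Ω] {e : Ω → Ω → K} {k : K} {κ : Cardinal.{0}}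

theorem SpkNode.eq_of {s t : SpkNode e k κ} (h : s.top = t.top)
    (h' : ∀ ξ ≤ s.top, s.fn ξ = t.fn ξ) : s = t := by
  obtain ⟨a, f, hf, _⟩ := s
  obtain ⟨b, g, hg, _⟩ := t
  obtain rfl : a = b := h
  obtain rfl : f = g := by
    funext ξ
    rcases le_or_gt ξ a with h1 | h1
    · exact h' ξ h1
    · rw [hf ξ h1, hg ξ h1]
  rfl

instance SpkNode.po : PartialOrder (SpkNode e k κ) where
  le s t := s.top ≤ t.top ∧ ∀ ξ ≤ s.top, s.fn ξ = t.fn ξ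
  le_refl s := ⟨le_rfl, fun _ _ => rfl⟩
  le_trans s t u h1 h2 := ⟨h1.1.trans h2.1, fun ξ hξ =>
    (h1.2 ξ hξ).trans (h2.2 ξ (hξ.trans h1.1))⟩
  le_antisymm s t h1 h2 := SpkNode.eq_of (le_antisymm h1.1 h2.1) h1.2

theorem SpkNode.le_def {s t : SpkNode e k κ} :
    s ≤ t ↔ s.top ≤ t.top ∧ ∀ ξ ≤ s.top, s.fn ξ = t.fn ξ := Iff.rfl

theorem SpkNode.lt_def {s t : SpkNode e k κ} :
    s < t ↔ s.top < t.top ∧ ∀ ξ ≤ s.top, s.fn ξ = t.fn ξ := by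
  constructor
  · intro h
    refine ⟨lt_of_le_of_ne h.le.1 fun h' => h.ne (SpkNode.eq_of h' h.le.2), h.le.2⟩
  · rintro ⟨h1, h2⟩
    refine lt_of_le_of_ne ⟨h1.le, h2⟩ ?_
    rintro rfl
    exact lt_irrefl _ h1

theorem SpkNode.lt_of_lt {s s' t : SpkNode e k κ} (h : s ≤ t) (h' : s' ≤ t) (hl : s.top < s'.top) :
    s < s' := SpkNode.lt_def.2 ⟨hl, fun ξ hξ => (h.2 ξ hξ).trans (h'.2 ξ (hξ.trans hl.le)).symm⟩

theorem SpkNode.exists_restrict (hκ : ℵ₀ ≤ κ)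
    (he : ∀ γ β, β ≤ γ → #{ξ | ξ ≤ β ∧ e β ξ ≠ e γ ξ} < κ) (t : SpkNode e k κ) (β : Ω)
    (hβ : β < t.top) : ∃ s, s < t ∧ s.top = β := by
  classical
  refine ⟨⟨β, fun ξ => if ξ ≤ β then t.fn ξ else k, fun ξ hξ => if_neg hξ.not_ge, ?_⟩,
    SpkNode.lt_def.2 ⟨hβ, fun ξ hξ => if_pos hξ⟩, rfl⟩
  refine (mk_le_mk_of_subset (t := {ξ | ξ ≤ t.top ∧ t.fn ξ ≠ e t.top ξ} ∪
    {ξ | ξ ≤ β ∧ e β ξ ≠ e t.top ξ}) ?_).trans_lt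
    ((mk_union_le _ _).trans_lt (add_lt_of_lt hκ t.coh (he _ _ hβ.le)))
  rintro ξ ⟨h1, h2⟩
  rw [if_pos h1] at h2
  by_cases h3 : t.fn ξ = e t.top ξ
  · right
    exact ⟨h1, fun h4 => h2 (h3.trans h4.symm)⟩
  · left
    exact ⟨h1.trans hβ.le, h3⟩

theorem SpkNode.iso (hκ : ℵ₀ ≤ κ)
    (he : ∀ γ β, β ≤ γ → #{ξ | ξ ≤ β ∧ e β ξ ≠ e γ ξ} < κ) (t : SpkNode e k κ) :
    Nonempty (((· < ·) : {s // s < t} → {s // s < t} → Prop) ≃r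
      ((· < ·) : Set.Iio t.top → Set.Iio t.top → Prop)) := by
  let f : {s // s < t} → Set.Iio t.top := fun s => ⟨s.1.top, (SpkNode.lt_def.1 s.2).1⟩
  have hf : Function.Bijective f := by
    constructor
    · intro s s' h
      have h' : s.1.top = s'.1.top := congrArg Subtype.val h
      refine Subtype.ext (SpkNode.eq_of h' fun ξ hξ => ?_)
      exact (s.2.le.2 ξ hξ).trans (s'.2.le.2 ξ (hξ.trans h'.le)).symm
    · rintro ⟨β, hβ⟩
      obtain ⟨s, h1, h2⟩ := SpkNode.exists_restrict hκ he t β hβ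
      exact ⟨⟨s, h1⟩, Subtype.ext h2⟩
  refine ⟨⟨Equiv.ofBijective f hf, ?_⟩⟩
  intro s s'
  constructor
  · intro h
    exact SpkNode.lt_of_lt s.2.le s'.2.le h
  · intro h
    exact (SpkNode.lt_def.1 (show s.1 < s'.1 from h)).1

theorem SpkNode.mk_level (hκ : ℵ₀ ≤ κ) (h : κ ^< κ = κ) (hK : #K ≤ κ)
    (β : Ω) (hβ : #(Set.Iic β) ≤ κ) : #{t : SpkNode e k κ // t.top = β} ≤ κ := by
  refine le_trans ?_ (spk_mk_small hκ h (Set.Iic β × K) ?_)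
  · let D : SpkNode e k κ → Set Ω := fun t => {ξ | ξ ≤ t.top ∧ t.fn ξ ≠ e t.top ξ}
    refine mk_le_of_injective (f := fun t => ⟨{p | p.1.1 ∈ D t.1 ∧ p.2 = t.1.fn p.1.1}, ?_⟩) ?_
    · refine lt_of_le_of_lt ?_ t.1.coh
      refine mk_le_of_injective (f := fun p => (⟨p.1.1.1, p.2.1⟩ : D t.1)) ?_
      rintro ⟨⟨⟨a, ha⟩, x⟩, h1, h2⟩ ⟨⟨⟨b, hb⟩, y⟩, h3, h4⟩ h5
      simp only [Subtype.mk.injEq] at h5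
      subst h5
      simp only at h2 h4
      subst h2
      subst h4
      rfl
    · rintro ⟨s, hs⟩ ⟨t, ht⟩ hst
      simp only [Subtype.mk.injEq] at hst
      refine Subtype.ext (SpkNode.eq_of (hs.trans ht.symm) fun ξ hξ => ?_)
      have hst' := Set.ext_iff.1 hst
      have hst'' : ∀ x, ξ ∈ D s ∧ x = s.fn ξ ↔ ξ ∈ D t ∧ x = t.fn ξ :=
        fun x => hst' (⟨ξ, hξ.trans hs.le⟩, x)
      by_cases hD : ξ ∈ D s
      · exact ((hst'' (s.fn ξ)).1 ⟨hD, rfl⟩).2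
      · by_cases hD' : ξ ∈ D t
        · exact (((hst'' (t.fn ξ)).2 ⟨hD', rfl⟩).2).symm
        · have a1 : s.fn ξ = e s.top ξ := by
            by_contra hh
            exact hD ⟨hξ, hh⟩
          have a2 : t.fn ξ = e t.top ξ := by
            by_contra hh
            exact hD' ⟨(hξ.trans hs.le).trans ht.ge, hh⟩
          rw [a1, a2, hs, ht]
  · rw [mk_prod, lift_id, lift_id]
    exact (mul_le_mul' hβ hK).trans (mul_eq_self hκ).le

/-- specialising function -/
theorem SpkNode.special [WellFoundedLT Ω] [LinearOrder K] (hκ : ℵ₀ ≤ κ) (hK : #K ≤ κ)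
    (he : ∀ γ v, #{ξ | ξ ≤ γ ∧ e γ ξ ≤ v} < κ) :
    ∃ (ι : Type) (_ : #ι ≤ κ) (g : SpkNode e k κ → ι), ∀ s t, s < t → g s ≠ g t := by
  let A : SpkNode e k κ → Set Ω := fun t => {ξ | ξ < t.top ∧ t.fn ξ = t.fn t.top}
  let o : SpkNode e k κ → Ordinal.{0} := fun t =>
    Ordinal.type ((· < ·) : A t → A t → Prop)
  have ho : ∀ t, o t < κ.ord := by
    intro t
    rw [lt_ord, Ordinal.card_type]
    refine (mk_le_mk_of_subset (t := {ξ | ξ ≤ t.top ∧ t.fn ξ ≠ e t.top ξ} ∪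
      {ξ | ξ ≤ t.top ∧ e t.top ξ ≤ t.fn t.top}) ?_).trans_lt
      ((mk_union_le _ _).trans_lt (add_lt_of_lt hκ t.coh (he _ _)))
    rintro ξ ⟨h1, h2⟩
    by_cases h3 : t.fn ξ = e t.top ξ
    · right
      exact ⟨h1.le, (h3.symm.trans h2).le⟩
    · left
      exact ⟨h1.le, h3⟩
  refine ⟨K × κ.ord.ToType, ?_, fun t => (t.fn t.top, Ordinal.ToType.mk ⟨o t, ho t⟩), ?_⟩
  · rw [mk_prod, lift_id, lift_id, mk_ord_toType]
    exact (mul_le_mul' hK le_rfl).trans (mul_eq_self hκ).le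
  · intro s t hst heq
    simp only [Prod.mk.injEq, EmbeddingLike.apply_eq_iff_eq] at heq
    obtain ⟨h1, h2⟩ := heq
    refine absurd h2 (ne_of_lt ?_)
    obtain ⟨h3, h4⟩ := SpkNode.lt_def.1 hst
    have h5 : s.top ∈ A t := ⟨h3, by rw [← h4 _ le_rfl, h1]⟩
    refine Ordinal.type_lt_iff.2 ⟨⟨⟨⟨fun x => ⟨x.1, ?_⟩, ?_⟩, ?_⟩, ⟨s.top, h5⟩, ?_⟩⟩
    · exact ⟨x.2.1.trans h3, by rw [← h4 _ x.2.1.le, x.2.2, h1]⟩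
    · intro x y hxy
      exact Subtype.ext (congrArg (fun z : A t => z.1) hxy)
    · intro x y
      exact Iff.rfl
    · rintro ⟨y, hy⟩
      constructor
      · rintro ⟨x, hx⟩
        have : x.1 = y := congrArg Subtype.val hx
        show y < s.top
        rw [← this]
        exact x.2.1
      · intro hlt
        have hlt' : y < s.top := hlt
        exact ⟨⟨y, hlt', by rw [h4 _ hlt'.le, hy.2, h1]⟩, rfl⟩

end

theorem spk_main {κ : Cardinal.{0}} (hκ : ℵ₀ ≤ κ) (h : κ ^< κ = κ) : ExistsAronszajn κ := by
  have hr := spk_regular hκ h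
  have hIic : ∀ i : κ.ord.ToType, #(Set.Iic i) < κ := by
    intro i
    rw [← Set.Iio_insert]
    refine (mk_insert_le).trans_lt (add_lt_of_lt hκ ?_ ?_)
    · simpa using mk_Iio_lt i
    · simpa using hr.nat_lt 1
  have hΩ : ∀ γ : (Order.succ κ).ord.ToType, #(Set.Iio γ) ≤ κ := by
    intro i
    rw [← Order.lt_succ_iff]
    simpa using mk_Iio_lt i
  have hΩ' : ∀ γ : (Order.succ κ).ord.ToType, #(Set.Iic γ) ≤ κ := by
    intro i
    rw [← Set.Iio_insert]
    refine (mk_insert_le).trans (add_le_of_le hκ (hΩ i) (one_le_aleph0.trans hκ))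
  have : Nonempty κ.ord.ToType := by
    rw [← mk_ne_zero_iff, mk_ord_toType]
    exact hr.ne_zero
  obtain ⟨e, he1, he2⟩ := spk_coh (Ω := (Order.succ κ).ord.ToType) (K := κ.ord.ToType) hr hIic
    (fun γ => by rw [mk_ord_toType]; exact hΩ γ)
  let k : κ.ord.ToType := Classical.arbitrary _
  let T := SpkNode e k κ
  have iso := fun t : T => SpkNode.iso hκ he2 t
  have wo : ∀ t : T, IsWellOrder {s : T // s < t} (· < ·) := fun t =>
    (iso t).some.toRelEmbedding.isWellOrder
  have hl : ∀ t : T, lvl t = Ordinal.typein (α := (Order.succ κ).ord.ToType) (· < ·) t.top := by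
    intro t
    rw [← Ordinal.type_Iio_lt]
    exact Ordinal.type_eq.2 (iso t)
  have sp := SpkNode.special (e := e) (k := k) hκ (mk_ord_toType κ).le he1
  have hlt : ∀ t : T, lvl t < (Order.succ κ).ord := by
    intro t
    rw [hl]
    exact Ordinal.typein_lt_self _
  refine ⟨T, inferInstance, wo, hlt, ?_, ?_, ?_, sp⟩
  · intro o ho
    let β : (Order.succ κ).ord.ToType := Ordinal.ToType.mk ⟨o, ho⟩
    refine ⟨⟨β, fun ξ => if ξ ≤ β then e β ξ else k, fun ξ hξ => if_neg hξ.not_ge, ?_⟩, ?_⟩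
    · have : {ξ | ξ ≤ β ∧ (if ξ ≤ β then e β ξ else k) ≠ e β ξ} = ∅ := by
        ext ξ
        simp only [Set.mem_ofPred_eq, Set.mem_empty_iff_false, iff_false, not_and, not_not]
        intro h
        rw [if_pos h]
      rw [this]
      simpa using hr.pos
    · rw [hl]
      exact Ordinal.typein_enum (α := (Order.succ κ).ord.ToType) (· < ·) _
  · intro o
    by_cases ho : o < (Order.succ κ).ord
    · let β : (Order.succ κ).ord.ToType := Ordinal.ToType.mk ⟨o, ho⟩
      have hβ : Ordinal.typein (α := (Order.succ κ).ord.ToType) (· < ·) β = o :=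
        Ordinal.typein_enum (α := (Order.succ κ).ord.ToType) (· < ·) _
      refine le_trans ?_ (SpkNode.mk_level (e := e) (k := k) hκ h (mk_ord_toType κ).le β (hΩ' β))
      refine mk_le_of_injective (f := fun t => ⟨t.1, ?_⟩) ?_
      · have := t.2
        rw [hl] at this
        exact Ordinal.typein_injective _ (this.trans hβ.symm)
      · intro s t hst
        exact Subtype.ext (congrArg (fun z : {t : T // t.top = β} => z.1) hst)
    · have : IsEmpty {t : T // lvl t = o} := ⟨fun t => ho (t.2 ▸ hlt t.1)⟩
      rw [mk_eq_zero]
      exact zero_le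
  · rintro ⟨B, hB, hB'⟩
    obtain ⟨ι, hι, g, hg⟩ := sp
    choose b hb1 hb2 using hB'
    let F : (Order.succ κ).ord.ToType → ι := fun x => g (b _ (Ordinal.typein_lt_self x))
    have hF : Function.Injective F := by
      intro x y hxy
      by_contra hne
      have hne' : b _ (Ordinal.typein_lt_self x) ≠ b _ (Ordinal.typein_lt_self y) := by
        intro h
        apply hne
        have := congrArg (fun t : T => lvl t) h
        simp only [hb2] at this
        exact Ordinal.typein_injective _ this
      rcases hB (hb1 _ (Ordinal.typein_lt_self x)) (hb1 _ (Ordinal.typein_lt_self y)) hne' with h | h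
      · exact hg _ _ (lt_of_le_of_ne h hne') hxy
      · exact hg _ _ (lt_of_le_of_ne h hne'.symm) hxy.symm
    have := mk_le_of_injective hF
    rw [mk_ord_toType] at this
    exact absurd (this.trans hι) (not_le.2 (Order.lt_succ κ))

/-- Specker's theorem: if `κ^{<κ} = κ` then there is a special `κ⁺`-Aronszajn tree;
in particular, if `κ` is inaccessible then `κ^{<κ} = κ`, hence the tree property
fails at `κ⁺`. -/
theorem stmt13 (κ : Cardinal) (hκ : ℵ₀ ≤ κ) :
    (κ ^< κ = κ → ExistsAronszajn κ) ∧
    (κ.IsInaccessible → κ ^< κ = κ ∧ ExistsAronszajn κ (fun _ => True)) := by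
  refine ⟨spk_main hκ, fun hi => ⟨spk_inacc hi, ?_⟩⟩
  obtain ⟨α, i1, i2, h1, h2, h3, h4, -⟩ := spk_main hκ (spk_inacc hi)
  exact ⟨α, i1, i2, h1, h2, h3, h4, trivial⟩
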